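/- arXiv:2312.09629 — 6 statements merged into one kernel-verified Lean document; each statement's English description precedes it below -/
import Mathlib

section
/- Theorem 1 (translation dynamics convergence). Let m, ρ, S > 0, c₀, c̄₀, c̿₀ ≥ 0, α₀ ∈ ℝ, g₀ ∈ ℝ, and let k₀ ∈ ℝ³ be a unit vector. Let i, j, k, iᵣ, jᵣ, kᵣ : ℝ → ℝ³ be such that for every t the triples (i(t), j(t), k(t)) and (iᵣ(t), jᵣ(t), kᵣ(t)) are orthonormal; define i₂ = cos α₀ • i − sin α₀ • k, k₂ = sin α₀ • i + cos α₀ • k, and analogously i₂ᵣ, k₂ᵣ from (iᵣ, kᵣ). Let v_a, a_r : ℝ → ℝ³ and T_fw, T_mc, T_fwᵣ, T_mcᵣ : ℝ → ℝ, and let v : ℝ → ℝ³ be differentiable with v′(t) = g₀ k₀ + (1/m)·F_a(t) + (1/m)·(T_fw(t) • i(t) + T_mc(t) • k(t)), where F_a(t) = −(1/2)ρS‖v_a(t)‖ (c₀⟪v_a(t), i₂(t)⟫ • i₂(t) + c̿₀⟪v_a(t), j(t)⟫ • j(t) + c̄₀⟪v_a(t), k₂(t)⟫ • k₂(t)). Assume: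 (a) for every t the reference force balance holds: m·(a_r(t) − g₀ k₀) = −(1/2)ρS‖v_a(t)‖ (c₀⟪v_a(t), i₂ᵣ(t)⟫ • i₂ᵣ(t) + c̿₀⟪v_a(t), jᵣ(t)⟫ • jᵣ(t) + c̄₀⟪v_a(t), k₂ᵣ(t)⟫ • k₂ᵣ(t)) + T_fwᵣ(t) • iᵣ(t) + T_mcᵣ(t) • kᵣ(t); (b) i − iᵣ, j − jᵣ, k − kᵣ, T_fw − T_fwᵣ and T_mc − T_mcᵣ all tend to 0 as t → ∞; (c) the functions ‖v_a‖, |T_fwᵣ| and |T_mcᵣ| are bounded on ℝ. Then v′(t) − a_r(t) → 0 as t → ∞. -/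
open scoped RealInnerProductSpace
open Filter Real

abbrev E3 : Type := EuclideanSpace ℝ (Fin 3)

noncomputable def cross3 (x y : E3) : E3 :=
  (WithLp.equiv 2 (Fin 3 → ℝ)).symm
    ![x 1 * y 2 - x 2 * y 1, x 2 * y 0 - x 0 * y 2, x 0 * y 1 - x 1 * y 0]

def Orthonormal3 (i j k : E3) : Prop :=
  ‖i‖ = 1 ∧ ‖j‖ = 1 ∧ ‖k‖ = 1 ∧ ⟪i, j⟫ = 0 ∧ ⟪i, k⟫ = 0 ∧ ⟪j, k⟫ = 0


section Perturbation

variable {ι E : Type*} {l : Filter ι}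

theorem tendsto_smul_sub_smul [NormedAddCommGroup E] [NormedSpace ℝ E]
    {a b : ι → ℝ} {x y : ι → E} {A X : ℝ}
    (hab : Tendsto (fun t => a t - b t) l (nhds 0))
    (hxy : Tendsto (fun t => x t - y t) l (nhds 0))
    (hb : ∀ t, |b t| ≤ A) (hx : ∀ t, ‖x t‖ ≤ X) :
    Tendsto (fun t => a t • x t - b t • y t) l (nhds 0) := by
  have hlim : Tendsto (fun t => |a t - b t| * X + A * ‖x t - y t‖) l (nhds 0) := by
    simpa using (hab.abs.mul_const X).add (hxy.norm.const_mul A)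
  refine squeeze_zero_norm (fun t => ?_) hlim
  have hsplit : a t • x t - b t • y t = (a t - b t) • x t + b t • (x t - y t) := by module
  calc ‖a t • x t - b t • y t‖ ≤ |a t - b t| * ‖x t‖ + |b t| * ‖x t - y t‖ := by
        rw [hsplit]
        simpa only [norm_smul, Real.norm_eq_abs] using
          norm_add_le ((a t - b t) • x t) (b t • (x t - y t))
    _ ≤ |a t - b t| * X + A * ‖x t - y t‖ := by
        gcongr
        exacts [hx t, hb t]

theorem tendsto_inner_smul_sub_inner_smul [NormedAddCommGroup E] [InnerProductSpace ℝ E]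
    {w x y : ι → E} {W X Y : ℝ}
    (hxy : Tendsto (fun t => x t - y t) l (nhds 0))
    (hw : ∀ t, ‖w t‖ ≤ W) (hx : ∀ t, ‖x t‖ ≤ X) (hy : ∀ t, ‖y t‖ ≤ Y) :
    Tendsto (fun t => ⟪w t, x t⟫ • x t - ⟪w t, y t⟫ • y t) l (nhds 0) := by
  refine tendsto_smul_sub_smul (A := W * Y) ?_ hxy (fun t => ?_) hx
  · have hlim : Tendsto (fun t => W * ‖x t - y t‖) l (nhds 0) := by
      simpa using hxy.norm.const_mul W
    refine squeeze_zero_norm (fun t => ?_) hlim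
    rw [← inner_sub_right]
    exact (norm_inner_le_norm _ _).trans (by gcongr; exact hw t)
  · have hW : 0 ≤ W := (norm_nonneg _).trans (hw t)
    exact (abs_real_inner_le_norm _ _).trans (by gcongr; exacts [hw t, hy t])

end Perturbation

/-- **Theorem 1 (translation dynamics convergence).** -/
theorem translation_dynamics_convergence
    (m ρ S : ℝ) (hm : 0 < m) (hρ : 0 < ρ) (hS : 0 < S)
    (c₀ cbar₀ cbb₀ : ℝ) (hc₀ : 0 ≤ c₀) (hcbar₀ : 0 ≤ cbar₀) (hcbb₀ : 0 ≤ cbb₀)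
    (α₀ g₀ : ℝ) (k₀ : E3) (hk₀ : ‖k₀‖ = 1)
    (i j k ir jr kr : ℝ → E3)
    (hON : ∀ t, Orthonormal3 (i t) (j t) (k t))
    (hONr : ∀ t, Orthonormal3 (ir t) (jr t) (kr t))
    (i₂ k₂ i₂r k₂r : ℝ → E3)
    (hi₂ : ∀ t, i₂ t = Real.cos α₀ • i t - Real.sin α₀ • k t)
    (hk₂ : ∀ t, k₂ t = Real.sin α₀ • i t + Real.cos α₀ • k t)
    (hi₂r : ∀ t, i₂r t = Real.cos α₀ • ir t - Real.sin α₀ • kr t)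
    (hk₂r : ∀ t, k₂r t = Real.sin α₀ • ir t + Real.cos α₀ • kr t)
    (va ar : ℝ → E3) (Tfw Tmc Tfwr Tmcr : ℝ → ℝ)
    (Fa : ℝ → E3)
    (hFa : ∀ t, Fa t = -((1/2) * ρ * S * ‖va t‖) •
      ((c₀ * ⟪va t, i₂ t⟫) • i₂ t + (cbb₀ * ⟪va t, j t⟫) • j t +
        (cbar₀ * ⟪va t, k₂ t⟫) • k₂ t))
    (v : ℝ → E3)
    (hv : ∀ t, HasDerivAt v
      (g₀ • k₀ + m⁻¹ • Fa t + m⁻¹ • (Tfw t • i t + Tmc t • k t)) t)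
    -- (a) reference force balance
    (hbal : ∀ t, m • (ar t - g₀ • k₀) =
      -((1/2) * ρ * S * ‖va t‖) •
        ((c₀ * ⟪va t, i₂r t⟫) • i₂r t + (cbb₀ * ⟪va t, jr t⟫) • jr t +
          (cbar₀ * ⟪va t, k₂r t⟫) • k₂r t)
      + Tfwr t • ir t + Tmcr t • kr t)
    -- (b) convergence of frames and thrusts
    (hconv_i : Tendsto (fun t => i t - ir t) atTop (nhds 0))
    (hconv_j : Tendsto (fun t => j t - jr t) atTop (nhds 0))
    (hconv_k : Tendsto (fun t => k t - kr t) atTop (nhds 0))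
    (hconv_fw : Tendsto (fun t => Tfw t - Tfwr t) atTop (nhds 0))
    (hconv_mc : Tendsto (fun t => Tmc t - Tmcr t) atTop (nhds 0))
    -- (c) boundedness
    (hbd_va : ∃ C, ∀ t, ‖va t‖ ≤ C)
    (hbd_fw : ∃ C, ∀ t, |Tfwr t| ≤ C)
    (hbd_mc : ∃ C, ∀ t, |Tmcr t| ≤ C) :
    Tendsto (fun t => deriv v t - ar t) atTop (nhds 0) := by
  obtain ⟨V, hV⟩ := hbd_va
  obtain ⟨F, hF⟩ := hbd_fw
  obtain ⟨M, hM⟩ := hbd_mc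
  have hi t : ‖i t‖ ≤ 1 := (hON t).1.le
  have hj t : ‖j t‖ ≤ 1 := (hON t).2.1.le
  have hk t : ‖k t‖ ≤ 1 := (hON t).2.2.1.le
  have hir t : ‖ir t‖ ≤ 1 := (hONr t).1.le
  have hjr t : ‖jr t‖ ≤ 1 := (hONr t).2.1.le
  have hkr t : ‖kr t‖ ≤ 1 := (hONr t).2.2.1.le
  have hbound (a b : ℝ) {x y : E3} (hx : ‖x‖ ≤ 1) (hy : ‖y‖ ≤ 1) :
      ‖a • x + b • y‖ ≤ |a| + |b| := by
    refine (norm_add_le _ _).trans ?_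
    rw [norm_smul, norm_smul, Real.norm_eq_abs, Real.norm_eq_abs]
    exact add_le_add (mul_le_of_le_one_right (abs_nonneg a) hx)
      (mul_le_of_le_one_right (abs_nonneg b) hy)
  have hi₂_eq t : i₂ t = Real.cos α₀ • i t + (-Real.sin α₀) • k t := by rw [hi₂]; module
  have hi₂r_eq t : i₂r t = Real.cos α₀ • ir t + (-Real.sin α₀) • kr t := by rw [hi₂r]; module
  have hconv_i₂ : Tendsto (fun t => i₂ t - i₂r t) atTop (nhds 0) := by
    have h := (hconv_i.const_smul (Real.cos α₀)).sub (hconv_k.const_smul (Real.sin α₀))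
    rw [smul_zero, smul_zero, sub_zero] at h
    refine h.congr fun t => ?_
    rw [hi₂, hi₂r]
    module
  have hconv_k₂ : Tendsto (fun t => k₂ t - k₂r t) atTop (nhds 0) := by
    have h := (hconv_i.const_smul (Real.sin α₀)).add (hconv_k.const_smul (Real.cos α₀))
    rw [smul_zero, smul_zero, add_zero] at h
    refine h.congr fun t => ?_
    rw [hk₂, hk₂r]
    module
  have hw t : ‖‖va t‖ • va t‖ ≤ V * V := by
    rw [norm_smul, norm_norm]
    exact mul_self_le_mul_self (norm_nonneg _) (hV t)
  have hdrag_i := tendsto_inner_smul_sub_inner_smul hconv_i₂ hw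
    (fun t => hi₂_eq t ▸ hbound _ _ (hi t) (hk t))
    (fun t => hi₂r_eq t ▸ hbound _ _ (hir t) (hkr t))
  have hdrag_j := tendsto_inner_smul_sub_inner_smul hconv_j hw hj hjr
  have hdrag_k := tendsto_inner_smul_sub_inner_smul hconv_k₂ hw
    (fun t => hk₂ t ▸ hbound _ _ (hi t) (hk t))
    (fun t => hk₂r t ▸ hbound _ _ (hir t) (hkr t))
  have hdrag := ((hdrag_i.const_smul c₀).add (hdrag_j.const_smul cbb₀)).add
    (hdrag_k.const_smul cbar₀)
  have hthrust := (tendsto_smul_sub_smul hconv_fw hconv_i hF hi).add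
    (tendsto_smul_sub_smul hconv_mc hconv_k hM hk)
  have h := ((hdrag.const_smul (-((1/2) * ρ * S))).add hthrust).const_smul m⁻¹
  simp only [smul_zero, add_zero] at h
  refine h.congr fun t => ?_
  have har : ar t = g₀ • k₀ + m⁻¹ • (m • (ar t - g₀ • k₀)) := by
    rw [inv_smul_smul₀ hm.ne']
    module
  rw [(hv t).deriv, har, hbal, hFa]
  simp only [real_inner_smul_left]
  module
end

section
/- Existence of the thrust/attitude setpoint with imposed thrust direction (Appendix A, case 1). Let m, ρ, S > 0, c₀, c̄₀, c̿₀ ≥ 0, and α₀, γ_T ∈ ℝ. Let a′, v_a ∈ ℝ³ satisfy a′ ≠ 0 and v_a × a′ ≠ 0. Set jᵣ = (v_a × a′)/‖v_a × a′‖ and a′⊥ = a′ × jᵣ. Then there exist γ ∈ ℝ and Tₙ ∈ ℝ such that, defining i₂ᵣ = cos(γ + α₀) • (a′/‖a′‖) − sin(γ + α₀) • (a′⊥/‖a′⊥‖) and k₂ᵣ = sin(γ + α₀) • (a′/‖a′‖) + cos(γ + α₀) • (a′⊥/‖a′⊥‖), the force balance m • a′ = −(1/2)ρS‖v_a‖ (c₀⟪v_a,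 i₂ᵣ⟫ • i₂ᵣ + c̿₀⟪v_a, jᵣ⟫ • jᵣ + c̄₀⟪v_a, k₂ᵣ⟫ • k₂ᵣ) + Tₙ • (cos(γ_T + α₀) • i₂ᵣ + sin(γ_T + α₀) • k₂ᵣ) holds. -/
open scoped RealInnerProductSpace
open Filter Real

theorem inner_cross3_self_left (x y : E3) : ⟪x, cross3 x y⟫ = 0 := by
  simp [cross3, PiLp.inner_apply, Fin.sum_univ_three]
  ring

/-- A continuous real function that changes sign under a half-turn has a zero. -/
theorem exists_eq_zero_of_antiperiodic {f : ℝ → ℝ} (hf : Continuous f)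
    (hanti : Function.Antiperiodic f π) : ∃ θ, f θ = 0 := by
  have h : f π = -f 0 := by simpa using hanti 0
  rcases le_total (f 0) 0 with h0 | h0
  · exact mem_range_of_exists_le_of_exists_ge hf ⟨0, h0⟩ ⟨π, by linarith⟩
  · exact mem_range_of_exists_le_of_exists_ge hf ⟨π, by linarith⟩ ⟨0, h0⟩

/-- Planar force balance: the frame obtained by rotating `e₁, e₂` can be chosen so that a constant
force along `e₁` plus an anisotropic linear drag is aligned with a direction fixed in the frame. -/
theorem exists_rotation_force_balance {E : Type*} [NormedAddCommGroup E] [InnerProductSpace ℝ E]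
    (e₁ e₂ v : E) (M A B β : ℝ) :
    ∃ θ T : ℝ,
      M • e₁ =
        -(A * ⟪v, cos θ • e₁ - sin θ • e₂⟫) • (cos θ • e₁ - sin θ • e₂)
          - (B * ⟪v, sin θ • e₁ + cos θ • e₂⟫) • (sin θ • e₁ + cos θ • e₂)
          + T • (cos β • (cos θ • e₁ - sin θ • e₂) + sin β • (sin θ • e₁ + cos θ • e₂)) := by
  let x : ℝ → ℝ := fun θ => M * cos θ + A * ⟪v, cos θ • e₁ - sin θ • e₂⟫
  let y : ℝ → ℝ := fun θ => M * sin θ + B * ⟪v, sin θ • e₁ + cos θ • e₂⟫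
  obtain ⟨θ, hθ⟩ : ∃ θ, cos β * y θ - sin β * x θ = 0 := by
    refine exists_eq_zero_of_antiperiodic (f := fun θ => cos β * y θ - sin β * x θ) ?_ ?_
    · simp only [x, y]
      fun_prop
    · intro θ
      simp only [x, y, cos_add_pi, sin_add_pi, inner_sub_right, inner_add_right,
        real_inner_smul_right]
      ring
  have hβ := sin_sq_add_cos_sq β
  refine ⟨θ, cos β * x θ + sin β * y θ, ?_⟩
  have hx : (cos β * x θ + sin β * y θ) * cos β = x θ := by
    linear_combination x θ * hβ + sin β * hθ
  have hy : (cos β * x θ + sin β * y θ) * sin β = y θ := by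
    linear_combination y θ * hβ - cos β * hθ
  have he : M • e₁ = (M * cos θ) • (cos θ • e₁ - sin θ • e₂)
      + (M * sin θ) • (sin θ • e₁ + cos θ • e₂) := by
    match_scalars
    · linear_combination -M * sin_sq_add_cos_sq θ
    · ring
  rw [he, smul_add (cos β * x θ + sin β * y θ), smul_smul, smul_smul, hx, hy]
  simp only [x, y]
  module

/-- **Existence of the thrust/attitude setpoint with imposed thrust direction**
(Appendix A, case 1). -/
theorem thrust_attitude_setpoint_imposed_thrust_direction
    (m ρ S : ℝ) (hm : 0 < m) (hρ : 0 < ρ) (hS : 0 < S)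
    (c₀ cbar₀ cbb₀ : ℝ) (hc₀ : 0 ≤ c₀) (hcbar₀ : 0 ≤ cbar₀) (hcbb₀ : 0 ≤ cbb₀)
    (α₀ γT : ℝ) (a' va : E3) (ha' : a' ≠ 0) (hva : cross3 va a' ≠ 0) :
    ∃ γ Tn : ℝ,
      let jr : E3 := ‖cross3 va a'‖⁻¹ • cross3 va a'
      let aperp : E3 := cross3 a' jr
      let i₂r : E3 := Real.cos (γ + α₀) • (‖a'‖⁻¹ • a')
        - Real.sin (γ + α₀) • (‖aperp‖⁻¹ • aperp)
      let k₂r : E3 := Real.sin (γ + α₀) • (‖a'‖⁻¹ • a')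
        + Real.cos (γ + α₀) • (‖aperp‖⁻¹ • aperp)
      m • a' = -((1/2) * ρ * S * ‖va‖) •
          ((c₀ * ⟪va, i₂r⟫) • i₂r + (cbb₀ * ⟪va, jr⟫) • jr + (cbar₀ * ⟪va, k₂r⟫) • k₂r)
        + Tn • (Real.cos (γT + α₀) • i₂r + Real.sin (γT + α₀) • k₂r) := by
  set D : ℝ := (1/2) * ρ * S * ‖va‖
  set jr : E3 := ‖cross3 va a'‖⁻¹ • cross3 va a' with hjr
  set aperp : E3 := cross3 a' jr
  have hj : ⟪va, jr⟫ = 0 := by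
    rw [hjr, real_inner_smul_right, inner_cross3_self_left, mul_zero]
  have ha : m • a' = (m * ‖a'‖) • (‖a'‖⁻¹ • a') := by
    rw [smul_smul, mul_assoc, mul_inv_cancel₀ (norm_ne_zero_iff.mpr ha'), mul_one]
  obtain ⟨θ, T, h⟩ := exists_rotation_force_balance (‖a'‖⁻¹ • a') (‖aperp‖⁻¹ • aperp) va
    (m * ‖a'‖) (D * c₀) (D * cbar₀) (γT + α₀)
  refine ⟨θ - α₀, T, ?_⟩
  intro _ _ i k
  simp only [i, k, sub_add_cancel]
  rw [ha, h, hj]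
  module
end

section
/- Rodrigues sum formula (Eq. (proof25)). Let u ∈ ℝ³ with ‖u‖ = 1, let θ ∈ ℝ, and define the rotation R : ℝ³ → ℝ³ by R x = cos θ • x + sin θ • (u × x) + (1 − cos θ)⟪u, x⟫ • u (Rodrigues' formula for rotation by angle θ about axis u). Then for every orthonormal basis (i, j, k) of ℝ³, i × R i + j × R j + k × R k = (2 sin θ) • u. -/
open scoped RealInnerProductSpace
open Filter Real

/-- The coordinates of an orthonormal triple in `E3` satisfy the resolution of the identity. -/
theorem Orthonormal3.sum_mul {i j k : E3} (h : Orthonormal3 i j k) (a b : Fin 3) :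
    i a * i b + j a * j b + k a * k b = if a = b then 1 else 0 := by
  obtain ⟨hi, hj, hk, hij, hik, hjk⟩ := h
  have norm_sq : ∀ x : E3, ‖x‖ = 1 → x 0 * x 0 + x 1 * x 1 + x 2 * x 2 = 1 := fun x hx ↦ by
    have := EuclideanSpace.real_norm_sq_eq x
    rw [hx, Fin.sum_univ_three] at this
    linarith
  have dot : ∀ x y : E3, ⟪x, y⟫ = 0 → x 0 * y 0 + x 1 * y 1 + x 2 * y 2 = 0 := fun x y hxy ↦ by
    simp only [PiLp.inner_apply, Fin.sum_univ_three, RCLike.inner_apply, conj_trivial] at hxy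
    linarith
  let A : Matrix (Fin 3) (Fin 3) ℝ := Matrix.of ![⇑i, ⇑j, ⇑k]
  have hA : A * A.transpose = 1 := by
    ext p q
    have := norm_sq i hi
    have := norm_sq j hj
    have := norm_sq k hk
    have := dot i j hij
    have := dot i k hik
    have := dot j k hjk
    fin_cases p <;> fin_cases q <;>
      simp [A, Matrix.mul_apply, Fin.sum_univ_three] <;> linarith
  have hA' : A.transpose * A = 1 := mul_eq_one_comm.mp hA
  have hab := congrFun (congrFun hA' a) b
  simpa [A, Matrix.mul_apply, Fin.sum_univ_three, Matrix.one_apply] using hab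

/-- **Rodrigues sum formula** (Eq. (proof25)). -/
theorem rodrigues_sum_formula
    (u : E3) (hu : ‖u‖ = 1) (θ : ℝ) (R : E3 → E3)
    (hR : ∀ x, R x = Real.cos θ • x + Real.sin θ • cross3 u x
      + ((1 - Real.cos θ) * ⟪u, x⟫) • u)
    (i j k : E3) (hON : Orthonormal3 i j k) :
    cross3 i (R i) + cross3 j (R j) + cross3 k (R k) = (2 * Real.sin θ) • u := by
  have d00 := hON.sum_mul 0 0
  have d11 := hON.sum_mul 1 1
  have d22 := hON.sum_mul 2 2
  have d01 := hON.sum_mul 0 1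
  have d02 := hON.sum_mul 0 2
  have d12 := hON.sum_mul 1 2
  simp only [Fin.isValue, ↓reduceIte, Fin.reduceEq] at d00 d11 d22 d01 d02 d12
  ext n
  fin_cases n <;>
    simp [hR, cross3, PiLp.inner_apply, Fin.sum_univ_three]
  · linear_combination (sin θ * u 0) * (d11 + d22) - sin θ * u 1 * d01 - sin θ * u 2 * d02
      + (1 - cos θ) * u 2 * (u 0 * d01 + u 1 * d11 + u 2 * d12)
      - (1 - cos θ) * u 1 * (u 0 * d02 + u 1 * d12 + u 2 * d22)
  · linear_combination (sin θ * u 1) * (d22 + d00) - sin θ * u 2 * d12 - sin θ * u 0 * d01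
      + (1 - cos θ) * u 0 * (u 1 * d12 + u 2 * d22 + u 0 * d02)
      - (1 - cos θ) * u 2 * (u 1 * d01 + u 2 * d02 + u 0 * d00)
  · linear_combination (sin θ * u 2) * (d00 + d11) - sin θ * u 0 * d02 - sin θ * u 1 * d12
      + (1 - cos θ) * u 1 * (u 2 * d02 + u 0 * d00 + u 1 * d01)
      - (1 - cos θ) * u 0 * (u 2 * d12 + u 0 * d01 + u 1 * d11)
end

section
/- Exponential decay of the attitude error (Eqs. (proof22)–(proof27)). Let λ > 0 and let θ : ℝ → ℝ be differentiable with θ(t) ∈ (0, π) for all t ≥ 0 and θ′(t) ≤ −2λ sin θ(t) for all t ≥ 0. Then for every t ≥ 0, tan(θ(t)/2) ≤ tan(θ(0)/2) · exp(−2λ t). -/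
/-- **Exponential decay of the attitude error** (Eqs. (proof22)–(proof27)). -/
theorem attitude_error_exponential_decay
    (lam : ℝ) (hlam : 0 < lam) (θ : ℝ → ℝ) (hθ : Differentiable ℝ θ)
    (hrange : ∀ t, 0 ≤ t → θ t ∈ Set.Ioo 0 Real.pi)
    (hineq : ∀ t, 0 ≤ t → deriv θ t ≤ -2 * lam * Real.sin (θ t)) :
    ∀ t, 0 ≤ t →
      Real.tan (θ t / 2) ≤ Real.tan (θ 0 / 2) * Real.exp (-2 * lam * t) := by
  have hcos : ∀ t, 0 ≤ t → 0 < Real.cos (θ t / 2) := fun t ht => by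
    obtain ⟨h0, hπ⟩ := hrange t ht
    exact Real.cos_pos_of_mem_Ioo ⟨by linarith, by linarith⟩
  have hderiv : ∀ t, 0 ≤ t →
      HasDerivAt (fun s => Real.tan (θ s / 2) * Real.exp (2 * lam * s))
        (1 / Real.cos (θ t / 2) ^ 2 * (deriv θ t / 2) * Real.exp (2 * lam * t) +
          Real.tan (θ t / 2) * (Real.exp (2 * lam * t) * (2 * lam * 1))) t := fun t ht =>
    ((Real.hasDerivAt_tan (hcos t ht).ne').comp t ((hθ t).hasDerivAt.div_const 2)).mul
      (((hasDerivAt_id t).const_mul (2 * lam)).exp)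
  have hanti : AntitoneOn (fun s => Real.tan (θ s / 2) * Real.exp (2 * lam * s))
      (Set.Ici 0) := by
    refine antitoneOn_of_deriv_nonpos (convex_Ici 0)
      (fun t ht => (hderiv t ht).continuousAt.continuousWithinAt)
      (fun t ht => (hderiv t (interior_subset ht)).differentiableAt.differentiableWithinAt)
      fun t ht => ?_
    have ht0 : 0 ≤ t := interior_subset ht
    have hc := hcos t ht0
    have hsin : Real.sin (θ t) = 2 * Real.sin (θ t / 2) * Real.cos (θ t / 2) := by
      rw [← Real.sin_two_mul, mul_div_cancel₀ _ two_ne_zero]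
    have hfactor : 1 / Real.cos (θ t / 2) ^ 2 * (deriv θ t / 2) * Real.exp (2 * lam * t) +
        Real.tan (θ t / 2) * (Real.exp (2 * lam * t) * (2 * lam * 1)) =
        Real.exp (2 * lam * t) / (2 * Real.cos (θ t / 2) ^ 2) *
          (deriv θ t + 2 * lam * Real.sin (θ t)) := by
      rw [hsin, Real.tan_eq_sin_div_cos]
      field_simp
    rw [(hderiv t ht0).deriv, hfactor]
    exact mul_nonpos_of_nonneg_of_nonpos (by positivity) (by linarith [hineq t ht0])
  intro t ht
  have h := hanti Set.self_mem_Ici ht ht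
  simp only [mul_zero, Real.exp_zero, mul_one] at h
  rw [neg_mul, neg_mul, Real.exp_neg, ← div_eq_mul_inv, le_div_iff₀ (Real.exp_pos _)]
  exact h
end

section
/- Equivalent lift and drag coefficients at zero side-slip (Section II.B). Let i, k ∈ ℝ³ with ‖i‖ = ‖k‖ = 1 and ⟪i, k⟫ = 0, let ρ, S > 0, c₀, c̄₀ ≥ 0, α, α₀ ∈ ℝ and V > 0. Set v_a = V • (cos α • i + sin α • k), i₂ = cos α₀ • i − sin α₀ • k, k₂ = sin α₀ • i + cos α₀ • k, and F_a = −(1/2)ρSV (c₀⟪v_a, i₂⟫ • i₂ + c̄₀⟪v_a, k₂⟫ • k₂). Then ⟪F_a, (1/V) • v_a⟫ = −(1/2)ρSV² (c₀ + (c̄₀ − c₀) sin²(α + α₀)) and ⟪F_a, −sin α • i + cos α • k⟫ = −(1/2)ρSV² · (1/2)(c̄₀ − c₀) sin(2(α + α₀)); that is, the equivalent drag and lift coefficients are C_D(α) = c₀ + (c̄₀ − c₀) sin²(α + α₀) and C_L(α) = (1/2)(c̄₀ − c₀) sin(2(α + α₀)). -/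
open scoped RealInnerProductSpace
open Filter Real

/-- The inner product of two vectors in the plane of an orthonormal pair, in coordinates. -/
theorem inner_planar {i k : E3} (hi : ‖i‖ = 1) (hk : ‖k‖ = 1) (hik : ⟪i, k⟫ = 0)
    (a b c d : ℝ) : ⟪a • i + b • k, c • i + d • k⟫ = a * c + b * d := by
  have hki : ⟪k, i⟫ = 0 := by rw [real_inner_comm, hik]
  simp only [inner_add_left, inner_add_right, real_inner_smul_left, real_inner_smul_right,
    real_inner_self_eq_norm_sq, hi, hk, hik, hki]
  ring

/-- **Equivalent lift and drag coefficients at zero side-slip** (Section II.B). -/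
theorem equivalent_lift_drag_coefficients
    (i k : E3) (hi : ‖i‖ = 1) (hk : ‖k‖ = 1) (hik : ⟪i, k⟫ = 0)
    (ρ S : ℝ) (hρ : 0 < ρ) (hS : 0 < S)
    (c₀ cbar₀ : ℝ) (hc₀ : 0 ≤ c₀) (hcbar₀ : 0 ≤ cbar₀)
    (α α₀ V : ℝ) (hV : 0 < V)
    (va i₂ k₂ Fa : E3)
    (hva : va = V • (Real.cos α • i + Real.sin α • k))
    (hi₂ : i₂ = Real.cos α₀ • i - Real.sin α₀ • k)
    (hk₂ : k₂ = Real.sin α₀ • i + Real.cos α₀ • k)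
    (hFa : Fa = -((1/2) * ρ * S * V) • ((c₀ * ⟪va, i₂⟫) • i₂ + (cbar₀ * ⟪va, k₂⟫) • k₂)) :
    ⟪Fa, V⁻¹ • va⟫ =
      -((1/2) * ρ * S * V ^ 2) * (c₀ + (cbar₀ - c₀) * Real.sin (α + α₀) ^ 2) ∧
    ⟪Fa, -Real.sin α • i + Real.cos α • k⟫ =
      -((1/2) * ρ * S * V ^ 2) * ((1/2) * (cbar₀ - c₀) * Real.sin (2 * (α + α₀))) := by
  have hi₂' : i₂ = cos α₀ • i + (-sin α₀) • k := by rw [hi₂, neg_smul, sub_eq_add_neg]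
  have hd : V⁻¹ • va = cos α • i + sin α • k := by rw [hva, inv_smul_smul₀ hV.ne']
  have hvi : ⟪va, i₂⟫ = V * cos (α + α₀) := by
    rw [hva, hi₂', real_inner_smul_left, inner_planar hi hk hik, cos_add]
    ring
  have hvk : ⟪va, k₂⟫ = V * sin (α + α₀) := by
    rw [hva, hk₂, real_inner_smul_left, inner_planar hi hk hik, sin_add]
    ring
  have hid : ⟪i₂, cos α • i + sin α • k⟫ = cos (α + α₀) := by
    rw [hi₂', inner_planar hi hk hik, cos_add]
    ring
  have hkd : ⟪k₂, cos α • i + sin α • k⟫ = sin (α + α₀) := by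
    rw [hk₂, inner_planar hi hk hik, sin_add]
    ring
  have hil : ⟪i₂, -sin α • i + cos α • k⟫ = -sin (α + α₀) := by
    rw [hi₂', inner_planar hi hk hik, sin_add]
    ring
  have hkl : ⟪k₂, -sin α • i + cos α • k⟫ = cos (α + α₀) := by
    rw [hk₂, inner_planar hi hk hik, cos_add]
    ring
  have hF (w : E3) : ⟪Fa, w⟫ = -((1/2) * ρ * S * V ^ 2) *
      (c₀ * cos (α + α₀) * ⟪i₂, w⟫ + cbar₀ * sin (α + α₀) * ⟪k₂, w⟫) := by
    rw [hFa, real_inner_smul_left, inner_add_left, real_inner_smul_left, real_inner_smul_left,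
      hvi, hvk]
    ring
  constructor
  · rw [hd, hF, hid, hkd]
    linear_combination (-((1/2) * ρ * S * V ^ 2) * c₀) * cos_sq' (α + α₀)
  · rw [hF, hil, hkl, sin_two_mul]
    ring
end

section
/- Singularity avoidance for the yaw-referenced desired lateral axis (Section III.B.4). Let g₀ > 0, let k₀ ∈ ℝ³ be a unit vector, let a_r ∈ ℝ³ with ⟪a_r, k₀⟫ < g₀, set a′ = a_r − g₀ • k₀, and let h ∈ ℝ³ with ‖h‖ = 1 and ⟪h, k₀⟫ = 0. Then h × a′ ≠ 0. -/
open scoped RealInnerProductSpace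
open Filter Real

/-- The Binet–Cauchy identity for the cross product on `E3`. -/
theorem inner_cross3_cross3 (u v w x : E3) :
    ⟪cross3 u v, cross3 w x⟫ = ⟪u, w⟫ * ⟪v, x⟫ - ⟪u, x⟫ * ⟪v, w⟫ := by
  simp [cross3, PiLp.inner_apply, Fin.sum_univ_three]
  ring

/-- **Singularity avoidance for the yaw-referenced desired lateral axis**
(Section III.B.4). -/
theorem yaw_reference_no_singularity
    (g₀ : ℝ) (hg₀ : 0 < g₀) (k₀ : E3) (hk₀ : ‖k₀‖ = 1)
    (ar : E3) (har : ⟪ar, k₀⟫ < g₀)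
    (a' : E3) (ha' : a' = ar - g₀ • k₀)
    (h : E3) (hh : ‖h‖ = 1) (hhor : ⟪h, k₀⟫ = 0) :
    cross3 h a' ≠ 0 := by
  intro hcross
  have key := inner_cross3_cross3 h a' h k₀
  rw [hcross, inner_zero_left, real_inner_self_eq_norm_sq, hh, hhor, ha', inner_sub_left,
    real_inner_smul_left, real_inner_self_eq_norm_sq, hk₀] at key
  linarith
end
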